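/- Regret of dual-stabilized OMD with a strongly convex mirror map (Corollary 1, DS-OMD case). Let ‖·‖ be a norm on ℝⁿ with dual norm ‖q‖_* := sup{⟨q, v⟩ : ‖v‖ ≤ 1}, let ρ > 0, and suppose Φ(u) ≥ Φ(v) + ⟨∇Φ(v), u − v⟩ + (ρ/2)‖u − v‖² for all u ∈ X and v ∈ X ∩ D. Let η : ℕ → ℝ_{>0} be nonincreasing and γ_t := η_{t+1}/η_t. Let {f_t}_{t≥1} be convex functions f_t : X → ℝ, and let sequences {x_t}_{t≥1} ⊆ X ∩ D, {w_t}_{t≥2}, {y_t}_{t≥2} ⊆ D, {g_t}_{t≥1} ⊆ ℝⁿ satisfy for every t ≥ 1: g_t is a subgradient of f_t at x_t on X; ∇Φ(w_{t+1}) = ∇Φ(x_t) − η_t g_t; ∇Φ(y_{t+1}) = γ_t ∇Φ(w_{t+1}) + (1−γ_t) ∇Φ(x_1); and x_{t+1} ∈ X ∩ D satisfies D_Φ(x_{t+1}, y_{t+1}) ≤ D_Φ(x, y_{t+1}) for all x ∈ X. Then for every T ≥ 1 and z ∈ X: Σ_{t=1}^T (f_t(x_t) − f_t(z)) ≤ Σ_{t=1}^T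 η_t ‖g_t‖_*² / (2ρ) + D_Φ(z, x_1)/η_{T+1}. -/

import Mathlib

/-! Regret of dual-stabilized OMD with a strongly convex mirror map
(Corollary 1, DS-OMD case). -/

open scoped RealInnerProductSpace BigOperators

/-- Bregman divergence `D_Φ(x,y) = Φ(x) − Φ(y) − ⟨∇Φ(y), x − y⟩`. -/
noncomputable def bregman {n : ℕ} (Φ : EuclideanSpace ℝ (Fin n) → ℝ)
    (Φ' : EuclideanSpace ℝ (Fin n) → EuclideanSpace ℝ (Fin n))
    (x y : EuclideanSpace ℝ (Fin n)) : ℝ :=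
  Φ x - Φ y - ⟪Φ' y, x - y⟫

/-- The dual norm `‖q‖_* = sup {⟨q, v⟩ : ‖v‖ ≤ 1}` of a norm `N` on `ℝⁿ`. -/
noncomputable def dualNorm {n : ℕ} (N : EuclideanSpace ℝ (Fin n) → ℝ)
    (q : EuclideanSpace ℝ (Fin n)) : ℝ :=
  sSup ((fun v => ⟪q, v⟫) '' {v | N v ≤ 1})

theorem aux_norm_lower {n : ℕ} (N : EuclideanSpace ℝ (Fin n) → ℝ)
    (hN0 : ∀ v, 0 ≤ N v) (hNdef : ∀ v, N v = 0 ↔ v = 0)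
    (hNsmul : ∀ (r : ℝ) v, N (r • v) = |r| * N v)
    (hNtri : ∀ u v, N (u + v) ≤ N u + N v) :
    ∃ m : ℝ, 0 < m ∧ ∀ v, m * ‖v‖ ≤ N v := by
  have hconv : ConvexOn ℝ Set.univ N := by
    refine ⟨convex_univ, ?_⟩
    intro u _ v _ a b ha hb _
    have := hNtri (a • u) (b • v)
    rw [hNsmul, hNsmul, abs_of_nonneg ha, abs_of_nonneg hb] at this
    simpa using this
  have hcont : Continuous N := by
    have := hconv.continuousOn isOpen_univ
    simpa [continuousOn_univ] using this
  rcases (Metric.sphere (0 : EuclideanSpace ℝ (Fin n)) 1).eq_empty_or_nonempty with he | hne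
  · refine ⟨1, one_pos, fun v => ?_⟩
    by_cases hv : v = 0
    · subst hv; simpa using hN0 0
    · exfalso
      have : (‖v‖⁻¹ • v) ∈ Metric.sphere (0 : EuclideanSpace ℝ (Fin n)) 1 := by
        simp [norm_smul, hv]
      rw [he] at this
      exact this
  · obtain ⟨p, hp, hmin⟩ := (isCompact_sphere (0 : EuclideanSpace ℝ (Fin n)) 1).exists_isMinOn
      hne hcont.continuousOn
    have hp0 : p ≠ 0 := by
      rintro rfl
      simp at hp
    refine ⟨N p, lt_of_le_of_ne (hN0 p) (fun h => hp0 ((hNdef p).1 h.symm)), fun v => ?_⟩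
    by_cases hv : v = 0
    · subst hv; simpa using hN0 0
    · have hm : (‖v‖⁻¹ • v) ∈ Metric.sphere (0 : EuclideanSpace ℝ (Fin n)) 1 := by
        simp [norm_smul, hv]
      have h1 : N p ≤ N (‖v‖⁻¹ • v) := hmin hm
      rw [hNsmul, abs_of_nonneg (by positivity)] at h1
      have h2 : 0 < ‖v‖ := norm_pos_iff.2 hv
      calc N p * ‖v‖ ≤ (‖v‖⁻¹ * N v) * ‖v‖ := by gcongr
        _ = N v := by field_simp

theorem aux_dual {n : ℕ} (N : EuclideanSpace ℝ (Fin n) → ℝ)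
    (hN0 : ∀ v, 0 ≤ N v) (hNdef : ∀ v, N v = 0 ↔ v = 0)
    (hNsmul : ∀ (r : ℝ) v, N (r • v) = |r| * N v)
    (hNtri : ∀ u v, N (u + v) ≤ N u + N v) (q v : EuclideanSpace ℝ (Fin n)) :
    ⟪q, v⟫ ≤ dualNorm N q * N v := by
  obtain ⟨m, hm, hmN⟩ := aux_norm_lower N hN0 hNdef hNsmul hNtri
  have hb : BddAbove ((fun v => ⟪q, v⟫) '' {v | N v ≤ 1}) := by
    refine ⟨‖q‖ * (1 / m), ?_⟩
    rintro _ ⟨u, hu, rfl⟩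
    have h1 : ‖u‖ ≤ 1 / m := by
      rw [le_div_iff₀ hm, mul_comm]
      exact (hmN u).trans hu
    exact (real_inner_le_norm q u).trans (by gcongr)
  by_cases hv : v = 0
  · subst hv
    simp [(hNdef 0).2 rfl]
  · have hNv : 0 < N v := lt_of_le_of_ne (hN0 v) (fun h => hv ((hNdef v).1 h.symm))
    have h1 : ⟪q, (N v)⁻¹ • v⟫ ≤ dualNorm N q := by
      refine le_csSup hb ⟨(N v)⁻¹ • v, ?_, rfl⟩
      simp only [Set.mem_setOf_eq]
      rw [hNsmul, abs_of_nonneg (by positivity), inv_mul_cancel₀ hNv.ne']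
    rw [real_inner_smul_right, inv_mul_eq_div, div_le_iff₀ hNv] at h1
    exact h1

theorem aux_opt {n : ℕ} (X : Set (EuclideanSpace ℝ (Fin n)))
    (Φ : EuclideanSpace ℝ (Fin n) → ℝ)
    (Φ' : EuclideanSpace ℝ (Fin n) → EuclideanSpace ℝ (Fin n))
    (hX : Convex ℝ X) (a b : EuclideanSpace ℝ (Fin n)) (ha : a ∈ X)
    (hg : HasGradientAt Φ (Φ' a) a)
    (hmin : ∀ u ∈ X, bregman Φ Φ' a b ≤ bregman Φ Φ' u b)
    (z : EuclideanSpace ℝ (Fin n)) (hz : z ∈ X) :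
    0 ≤ ⟪Φ' a, z - a⟫ - ⟪Φ' b, z - a⟫ := by
  have h1 : IsMinOn (fun u => Φ u - ⟪Φ' b, u⟫) X a := by
    intro u hu
    have := hmin u hu
    simp only [bregman, inner_sub_right] at this
    simp only [Set.mem_setOf_eq]
    linarith
  have h2 : HasFDerivAt (fun u => Φ u - ⟪Φ' b, u⟫)
      (InnerProductSpace.toDual ℝ _ (Φ' a) - innerSL ℝ (Φ' b)) a :=
    hg.hasFDerivAt.sub (innerSL ℝ (Φ' b)).hasFDerivAt
  have h3 := h1.localize.hasFDerivWithinAt_nonneg h2.hasFDerivWithinAt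
    (sub_mem_posTangentConeAt_of_segment_subset (hX.segment_subset ha hz))
  simpa using h3

theorem ds_omd_regret_strongly_convex {n : ℕ}
    (D X : Set (EuclideanSpace ℝ (Fin n)))
    (Φ : EuclideanSpace ℝ (Fin n) → ℝ)
    (Φ' : EuclideanSpace ℝ (Fin n) → EuclideanSpace ℝ (Fin n))
    -- mirror map setup
    (hDopen : IsOpen D) (hDconv : Convex ℝ D) (hDne : D.Nonempty)
    (hΦconv : ConvexOn ℝ (closure D) Φ)
    (hΦstrict : StrictConvexOn ℝ D Φ)
    (hΦgrad : ∀ y ∈ D, HasGradientAt Φ (Φ' y) y)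
    (hΦbij : Set.BijOn Φ' D Set.univ)
    (hXclosed : IsClosed X) (hXconv : Convex ℝ X)
    (hXsub : X ⊆ closure D) (hXDne : (X ∩ D).Nonempty)
    -- `N` is a norm on ℝⁿ
    (N : EuclideanSpace ℝ (Fin n) → ℝ)
    (hN0 : ∀ v, 0 ≤ N v) (hNdef : ∀ v, N v = 0 ↔ v = 0)
    (hNsmul : ∀ (r : ℝ) v, N (r • v) = |r| * N v)
    (hNtri : ∀ u v, N (u + v) ≤ N u + N v)
    -- `Φ` is `ρ`-strongly convex on `X` w.r.t. `N`
    (ρ : ℝ) (hρ : 0 < ρ)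
    (hsc : ∀ u ∈ X, ∀ v ∈ X ∩ D,
      Φ v + ⟪Φ' v, u - v⟫ + ρ / 2 * (N (u - v)) ^ 2 ≤ Φ u)
    -- learning rates and stabilization parameters
    (η : ℕ → ℝ) (hη : ∀ t, 0 < η t) (hηmono : ∀ t, η (t + 1) ≤ η t)
    (γ : ℕ → ℝ) (hγ : ∀ t, γ t = η (t + 1) / η t)
    -- cost functions
    (f : ℕ → EuclideanSpace ℝ (Fin n) → ℝ)
    (hfconv : ∀ t, 1 ≤ t → ConvexOn ℝ X (f t))
    -- iterates of dual-stabilized OMD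
    (x w y g : ℕ → EuclideanSpace ℝ (Fin n))
    (hx : ∀ t, 1 ≤ t → x t ∈ X ∩ D)
    (hw : ∀ t, 2 ≤ t → w t ∈ D)
    (hy : ∀ t, 2 ≤ t → y t ∈ D)
    (hsubgrad : ∀ t, 1 ≤ t → ∀ z ∈ X, f t (x t) + ⟪g t, z - x t⟫ ≤ f t z)
    (hwstep : ∀ t, 1 ≤ t → Φ' (w (t + 1)) = Φ' (x t) - η t • g t)
    (hystep : ∀ t, 1 ≤ t →
      Φ' (y (t + 1)) = γ t • Φ' (w (t + 1)) + (1 - γ t) • Φ' (x 1))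
    (hproj : ∀ t, 1 ≤ t → ∀ u ∈ X,
      bregman Φ Φ' (x (t + 1)) (y (t + 1)) ≤ bregman Φ Φ' u (y (t + 1))) :
    ∀ T, 1 ≤ T → ∀ z ∈ X,
      ∑ t ∈ Finset.Icc 1 T, (f t (x t) - f t z) ≤
        ∑ t ∈ Finset.Icc 1 T, η t * (dualNorm N (g t)) ^ 2 / (2 * ρ)
        + bregman Φ Φ' z (x 1) / η (T + 1) := by
  intro T _ z hz
  have hnn : ∀ t, 1 ≤ t → ∀ s, 1 ≤ s → 0 ≤ bregman Φ Φ' (x t) (x s) := by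
    intro t ht s hs
    have := hsc _ (hx t ht).1 _ (hx s hs)
    have h2 : 0 ≤ ρ / 2 * (N (x t - x s)) ^ 2 := by positivity
    unfold bregman
    linarith
  have hnz : ∀ s, 1 ≤ s → 0 ≤ bregman Φ Φ' z (x s) := by
    intro s hs
    have := hsc _ hz _ (hx s hs)
    have h2 : 0 ≤ ρ / 2 * (N (z - x s)) ^ 2 := by positivity
    unfold bregman
    linarith
  have step : ∀ t, 1 ≤ t → f t (x t) - f t z ≤ η t * (dualNorm N (g t)) ^ 2 / (2 * ρ)
      + (bregman Φ Φ' z (x 1) - bregman Φ Φ' z (x (t + 1))) / η (t + 1)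
      - (bregman Φ Φ' z (x 1) - bregman Φ Φ' z (x t)) / η t := by
    intro t ht
    have e0 := hη t
    have e1 := hη (t + 1)
    have hopt := aux_opt X Φ Φ' hXconv (x (t + 1)) (y (t + 1)) (hx _ (by omega)).1
      (hΦgrad _ (hx _ (by omega)).2) (hproj t ht) z hz
    rw [hystep t ht, hwstep t ht, inner_add_left, real_inner_smul_left, real_inner_smul_left,
      inner_sub_left, real_inner_smul_left, hγ t] at hopt
    have hsg := hsubgrad t ht z hz
    have hd := aux_dual N hN0 hNdef hNsmul hNtri (g t) (-(x (t + 1) - x t))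
    have hNneg : N (-(x (t + 1) - x t)) = N (x (t + 1) - x t) := by
      have := hNsmul (-1) (x (t + 1) - x t)
      simpa using this
    rw [hNneg, inner_neg_right] at hd
    have hs := hsc _ (hx (t + 1) (by omega)).1 _ (hx t ht)
    have hB1 := hnn (t + 1) (by omega) 1 le_rfl
    set d := dualNorm N (g t)
    set M := N (x (t + 1) - x t)
    have hy1 : d * M ≤ η t * d ^ 2 / (2 * ρ) + (ρ / 2 * M ^ 2) / η t := by
      have : η t * d ^ 2 / (2 * ρ) + (ρ / 2 * M ^ 2) / η t - d * M
          = (η t * d - ρ * M) ^ 2 / (2 * ρ * η t) := by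
        field_simp
        ring
      have h2 : 0 ≤ (η t * d - ρ * M) ^ 2 / (2 * ρ * η t) := by positivity
      linarith
    have hs2 : (ρ / 2 * M ^ 2) / η t ≤ bregman Φ Φ' (x (t + 1)) (x t) / η t := by
      gcongr
      unfold bregman
      linarith
    have hinv : 0 ≤ 1 / η (t + 1) - 1 / η t :=
      sub_nonneg.2 (one_div_le_one_div_of_le e1 (hηmono t))
    have hB2 := mul_nonneg hinv hB1
    have hopt2 := div_nonneg hopt e1.le
    have key : (⟪Φ' (x (t + 1)), z - x (t + 1)⟫ -
        (η (t + 1) / η t * (⟪Φ' (x t), z - x (t + 1)⟫ - η t * ⟪g t, z - x (t + 1)⟫) +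
          (1 - η (t + 1) / η t) * ⟪Φ' (x 1), z - x (t + 1)⟫)) / η (t + 1)
        = ⟪g t, z - x (t + 1)⟫ - bregman Φ Φ' z (x (t + 1)) / η (t + 1)
          + (bregman Φ Φ' z (x t) - bregman Φ Φ' (x (t + 1)) (x t)) / η t
          + (1 / η (t + 1) - 1 / η t) *
            (bregman Φ Φ' z (x 1) - bregman Φ Φ' (x (t + 1)) (x 1)) := by
      simp only [bregman, inner_sub_right]
      field_simp
      ring
    rw [key] at hopt2
    have hr : (bregman Φ Φ' z (x 1) - bregman Φ Φ' z (x (t + 1))) / η (t + 1)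
      - (bregman Φ Φ' z (x 1) - bregman Φ Φ' z (x t)) / η t
      = (1 / η (t + 1) - 1 / η t) * bregman Φ Φ' z (x 1)
        - bregman Φ Φ' z (x (t + 1)) / η (t + 1) + bregman Φ Φ' z (x t) / η t := by
      ring
    rw [mul_sub, sub_div] at hopt2
    simp only [inner_sub_right] at hopt2 hsg hd
    linarith
  have main : ∀ T, ∑ t ∈ Finset.Icc 1 T, (f t (x t) - f t z) ≤
        ∑ t ∈ Finset.Icc 1 T, η t * (dualNorm N (g t)) ^ 2 / (2 * ρ)
        + (bregman Φ Φ' z (x 1) - bregman Φ Φ' z (x (T + 1))) / η (T + 1) := by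
    intro T
    induction T with
    | zero => simp
    | succ k ih =>
      rw [Finset.sum_Icc_succ_top (by omega), Finset.sum_Icc_succ_top (by omega)]
      have := step (k + 1) (by omega)
      linarith
  refine (main T).trans ?_
  have h1 := hnz (T + 1) (by omega)
  have h2 := hη (T + 1)
  gcongr
  linarith
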